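/- Thermodynamic compatibility of the original GPR model: suppose the smooth fields ρ, u, A, J, S satisfy on Ω the system (i) ∂_t ρ + ∂_k(ρ u_k) = 0; (ii) ∂_t(ρ u_i) + ∂_k(ρ u_i u_k) + ∂_i p + ∂_k σ_{ik} + ∂_k ω_{ik} = ρ g_i; (iii) ∂_t A_{ik} + ∂_k(u_m A_{im}) + u_j ∂_j A_{ik} − u_j ∂_k A_{ij} = −(1/θ₁) E_{A_{ik}}; (iv) ∂_t J_k + ∂_k(J_m u_m) + ∂_k T + u_j(∂_j J_k − ∂_k J_j) = −(1/θ₂) E_{J_k}; (v) ∂_t(ρS) + ∂_k(ρ S u_k) + ∂_k(ρ E_{J_k}) = (ρ/T)((1/θ₁) E_{A_{ik}} E_{A_{ik}} + (1/θ₂) E_{J_k} E_{J_k}). Then, with total energy density E := E₁ + E₂ + E₃ + E₄, the energy conservation law holds at every point of Ω: ∂_t E + ∂_k(E u_k) + ∂_k(p u_k) + ∂_k(u_i σ_{ik}) + ∂_k(u_i ω_{ik}) + ∂_k q_k = ρ g_i u_i. -/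

import Mathlib

/-!
Thermodynamic compatibility of the original GPR model.
-/

noncomputable section

open scoped BigOperators

/-- A space-time point: (spatial coordinates in ℝ³, time). -/
abbrev Pt : Type := (Fin 3 → ℝ) × ℝ

/-- Spatial partial derivative in the `k`-th coordinate direction. -/
def pd (k : Fin 3) (f : Pt → ℝ) (x : Pt) : ℝ :=
  fderiv ℝ f x ((Pi.single k 1 : Fin 3 → ℝ), (0 : ℝ))

/-- Time derivative. -/
def pdt (f : Pt → ℝ) (x : Pt) : ℝ :=
  fderiv ℝ f x ((0 : Fin 3 → ℝ), (1 : ℝ))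

/-- Trace-free (deviatoric) part of a 3×3 matrix. -/
def dev (M : Fin 3 → Fin 3 → ℝ) (i k : Fin 3) : ℝ :=
  M i k - (1 / 3) * (∑ m, M m m) * (if i = k then (1 : ℝ) else 0)

/-- Metric tensor `G = AᵀA` of a matrix field, at a point. -/
def Gm (A : Fin 3 → Fin 3 → Pt → ℝ) (x : Pt) (i k : Fin 3) : ℝ :=
  ∑ j, A j i x * A j k x

/-- Ideal-gas internal energy density `E₁ = ρ^γ e^{S/c_v}/(γ-1)`. -/
def E1 (γ cv : ℝ) (ρ S : Pt → ℝ) (x : Pt) : ℝ :=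
  ρ x ^ γ * Real.exp (S x / cv) / (γ - 1)

/-- Pressure `p = (γ-1) E₁`. -/
def press (γ cv : ℝ) (ρ S : Pt → ℝ) (x : Pt) : ℝ :=
  (γ - 1) * E1 γ cv ρ S x

/-- Temperature `T = E₁ / (ρ c_v)`. -/
def temp (γ cv : ℝ) (ρ S : Pt → ℝ) (x : Pt) : ℝ :=
  E1 γ cv ρ S x / (ρ x * cv)

/-- Kinetic energy density `E₂ = ½ ρ |u|²`. -/
def E2 (ρ : Pt → ℝ) (u : Fin 3 → Pt → ℝ) (x : Pt) : ℝ :=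
  (1 / 2) * ρ x * ∑ i, u i x * u i x

/-- Mesoscopic distortion energy density `E₃ = ¼ c_s² ρ G̊:G̊`. -/
def E3 (cs : ℝ) (ρ : Pt → ℝ) (A : Fin 3 → Fin 3 → Pt → ℝ) (x : Pt) : ℝ :=
  (1 / 4) * cs ^ 2 * ρ x * ∑ i, ∑ k, dev (Gm A x) i k * dev (Gm A x) i k

/-- Thermal-impulse energy density `E₄ = ½ c_h² ρ |J|²`. -/
def E4 (ch : ℝ) (ρ : Pt → ℝ) (J : Fin 3 → Pt → ℝ) (x : Pt) : ℝ :=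
  (1 / 2) * ch ^ 2 * ρ x * ∑ k, J k x * J k x

/-- Shear stress `σ_{ik} = ρ c_s² G_{ij} G̊_{jk}`. -/
def sigm (cs : ℝ) (ρ : Pt → ℝ) (A : Fin 3 → Fin 3 → Pt → ℝ) (i k : Fin 3) (x : Pt) : ℝ :=
  ρ x * cs ^ 2 * ∑ j, Gm A x i j * dev (Gm A x) j k

/-- Thermal stress `ω_{ik} = ρ c_h² J_i J_k`. -/
def omeg (ch : ℝ) (ρ : Pt → ℝ) (J : Fin 3 → Pt → ℝ) (i k : Fin 3) (x : Pt) : ℝ :=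
  ρ x * ch ^ 2 * J i x * J k x

/-- Heat flux `q_k = ρ c_h² T J_k`. -/
def heatq (γ cv ch : ℝ) (ρ S : Pt → ℝ) (J : Fin 3 → Pt → ℝ) (k : Fin 3) (x : Pt) : ℝ :=
  ρ x * ch ^ 2 * temp γ cv ρ S x * J k x

/-- Specific-energy derivative `E_{A_{ik}} = c_s² A_{ij} G̊_{jk}`. -/
def EA (cs : ℝ) (A : Fin 3 → Fin 3 → Pt → ℝ) (i k : Fin 3) (x : Pt) : ℝ :=
  cs ^ 2 * ∑ j, A i j x * dev (Gm A x) j k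

/-- Specific-energy derivative `E_{J_k} = c_h² J_k`. -/
def EJ (ch : ℝ) (J : Fin 3 → Pt → ℝ) (k : Fin 3) (x : Pt) : ℝ :=
  ch ^ 2 * J k x

/-- Total energy density `E = E₁ + E₂ + E₃ + E₄` of the original GPR model. -/
def Etot (γ cv cs ch : ℝ) (ρ S : Pt → ℝ) (u J : Fin 3 → Pt → ℝ)
    (A : Fin 3 → Fin 3 → Pt → ℝ) (x : Pt) : ℝ :=
  E1 γ cv ρ S x + E2 ρ u x + E3 cs ρ A x + E4 ch ρ J x

/-- The material derivative `∂_t f + w · ∇f` is the derivative along the space-time vector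
`(w, 1)`. -/
theorem fderiv_apply_material (f : Pt → ℝ) (x : Pt) (w : Fin 3 → ℝ) :
    fderiv ℝ f x (w, 1) = pdt f x + ∑ k, w k * pd k f x := by
  have hw : ((w, 1) : Pt) = (0, 1) + ∑ k, w k • ((Pi.single k 1 : Fin 3 → ℝ), (0 : ℝ)) := by
    ext i
    · fin_cases i <;> simp [Fin.sum_univ_three]
    · simp [Prod.snd_sum]
  rw [hw, map_add, map_sum]
  simp only [map_smul, smul_eq_mul, pdt, pd]

theorem fderiv_mul_apply {f h : Pt → ℝ} {x : Pt} (hf : DifferentiableAt ℝ f x)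
    (hh : DifferentiableAt ℝ h x) (v : Pt) :
    fderiv ℝ (fun y => f y * h y) x v = f x * fderiv ℝ h x v + fderiv ℝ f x v * h x := by
  rw [fderiv_fun_mul hf hh]
  simp [mul_comm]

theorem pd_mul {f h : Pt → ℝ} {x : Pt} (hf : DifferentiableAt ℝ f x)
    (hh : DifferentiableAt ℝ h x) (k : Fin 3) :
    pd k (fun y => f y * h y) x = f x * pd k h x + pd k f x * h x :=
  fderiv_mul_apply hf hh _

theorem pdt_mul {f h : Pt → ℝ} {x : Pt} (hf : DifferentiableAt ℝ f x)
    (hh : DifferentiableAt ℝ h x) :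
    pdt (fun y => f y * h y) x = f x * pdt h x + pdt f x * h x :=
  fderiv_mul_apply hf hh _

theorem pd_sum_mul {f h : Fin 3 → Pt → ℝ} {x : Pt} (hf : ∀ i, DifferentiableAt ℝ (f i) x)
    (hh : ∀ i, DifferentiableAt ℝ (h i) x) (k : Fin 3) :
    pd k (fun y => ∑ i, f i y * h i y) x
      = ∑ i, (f i x * pd k (h i) x + pd k (f i) x * h i x) := by
  have := fderiv_fun_sum (𝕜 := ℝ) (u := Finset.univ) (x := x)
    (A := fun i y => f i y * h i y) fun i _ => (hf i).mul (hh i)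
  rw [pd, this, sum_apply]
  exact Finset.sum_congr rfl fun i _ => pd_mul (hf i) (hh i) k

section Energies

variable {γ cv cs ch : ℝ} {ρ S : Pt → ℝ} {u J : Fin 3 → Pt → ℝ} {A : Fin 3 → Fin 3 → Pt → ℝ}
  {x : Pt}

theorem hasFDerivAt_E1 (hρ : DifferentiableAt ℝ ρ x) (hS : DifferentiableAt ℝ S x)
    (hx : ρ x ≠ 0) :
    HasFDerivAt (E1 γ cv ρ S)
      ((γ * E1 γ cv ρ S x / ρ x) • fderiv ℝ ρ x + (E1 γ cv ρ S x / cv) • fderiv ℝ S x) x := by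
  have h := ((hρ.hasFDerivAt.rpow_const (p := γ) (Or.inl hx)).mul
    (hS.hasFDerivAt.mul_const cv⁻¹).exp).mul_const (γ - 1)⁻¹
  refine (h.congr_fderiv ?_).congr_of_eventuallyEq (.of_forall fun y => ?_)
  · ext v
    all_goals
      simp only [E1, Real.rpow_sub_one hx, div_eq_mul_inv, ContinuousLinearMap.comp_apply,
        add_apply, smul_apply, smul_eq_mul]
      ring
  · simp [E1, div_eq_mul_inv]

theorem fderiv_E2 (hρ : DifferentiableAt ℝ ρ x) (hu : ∀ i, DifferentiableAt ℝ (u i) x) (v : Pt) :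
    fderiv ℝ (E2 ρ u) x v
      = (1 / 2) * (∑ i, u i x * u i x) * fderiv ℝ ρ x v
        + ρ x * ∑ i, u i x * fderiv ℝ (u i) x v := by
  have h := (hρ.hasFDerivAt.const_mul (1 / 2)).mul (HasFDerivAt.fun_sum (u := Finset.univ)
    fun i _ => (hu i).hasFDerivAt.mul (hu i).hasFDerivAt)
  have h' : HasFDerivAt (E2 ρ u) _ x := h
  rw [h'.fderiv]
  simp [Fin.sum_univ_three]
  ring

theorem differentiableAt_E2 (hρ : DifferentiableAt ℝ ρ x)
    (hu : ∀ i, DifferentiableAt ℝ (u i) x) : DifferentiableAt ℝ (E2 ρ u) x := by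
  unfold E2
  fun_prop

theorem E4_eq_E2 : E4 ch ρ J = fun y => ch ^ 2 * E2 ρ J y := by
  ext y
  simp only [E4, E2]
  ring

theorem differentiableAt_dev_Gm (hA : ∀ i k, DifferentiableAt ℝ (A i k) x) (i k : Fin 3) :
    DifferentiableAt ℝ (fun y => dev (Gm A y) i k) x := by
  unfold dev Gm
  fun_prop

theorem differentiableAt_E3 (hρ : DifferentiableAt ℝ ρ x)
    (hA : ∀ i k, DifferentiableAt ℝ (A i k) x) : DifferentiableAt ℝ (E3 cs ρ A) x := by
  have := differentiableAt_dev_Gm hA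
  unfold E3
  fun_prop

theorem differentiableAt_sigm (hρ : DifferentiableAt ℝ ρ x)
    (hA : ∀ i k, DifferentiableAt ℝ (A i k) x) (i k : Fin 3) :
    DifferentiableAt ℝ (sigm cs ρ A i k) x := by
  have := differentiableAt_dev_Gm hA
  unfold sigm Gm at *
  fun_prop

theorem fderiv_Gm (hA : ∀ i k, DifferentiableAt ℝ (A i k) x) (i k : Fin 3) (v : Pt) :
    fderiv ℝ (fun y => Gm A y i k) x v
      = ∑ j, (A j i x * fderiv ℝ (A j k) x v + fderiv ℝ (A j i) x v * A j k x) := by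
  have h := HasFDerivAt.fun_sum (u := Finset.univ)
    fun j _ => (hA j i).hasFDerivAt.mul (hA j k).hasFDerivAt
  have h' : HasFDerivAt (fun y => Gm A y i k) _ x := h
  rw [h'.fderiv]
  simp [mul_comm]

theorem fderiv_dev_Gm (hA : ∀ i k, DifferentiableAt ℝ (A i k) x) (i k : Fin 3) (v : Pt) :
    fderiv ℝ (fun y => dev (Gm A y) i k) x v
      = dev (fun i k => fderiv ℝ (fun y => Gm A y i k) x v) i k := by
  have hG (i k : Fin 3) : DifferentiableAt ℝ (fun y => Gm A y i k) x := by
    unfold Gm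
    fun_prop
  have h := (hG i k).hasFDerivAt.sub (((HasFDerivAt.fun_sum (u := Finset.univ)
    fun m _ => (hG m m).hasFDerivAt).const_mul (1 / 3)).mul_const (if i = k then (1 : ℝ) else 0))
  have h' : HasFDerivAt (fun y => dev (Gm A y) i k) _ x := h
  rw [h'.fderiv]
  simp only [dev, sub_apply, smul_apply, sum_apply, smul_eq_mul]
  ring

/-- For a variation `H` of `G = AᵀA` induced by a variation `B` of `A`, the variation of
`¼ G̊:G̊` is `(A G̊):B`. -/
theorem sum_dev_mul_dev_variation (B : Fin 3 → Fin 3 → ℝ) :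
    ∑ i, ∑ k, dev (Gm A x) i k
        * dev (fun i k => ∑ j, (A j i x * B j k + B j i * A j k x)) i k
      = 2 * ∑ i, ∑ k, (∑ j, A i j x * dev (Gm A x) j k) * B i k := by
  simp [dev, Gm, Fin.sum_univ_three]
  ring

theorem fderiv_E3 (hρ : DifferentiableAt ℝ ρ x) (hA : ∀ i k, DifferentiableAt ℝ (A i k) x)
    (v : Pt) :
    fderiv ℝ (E3 cs ρ A) x v
      = (1 / 4) * cs ^ 2 * (∑ i, ∑ k, dev (Gm A x) i k * dev (Gm A x) i k) * fderiv ℝ ρ x v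
        + ρ x * ∑ i, ∑ k, EA cs A i k x * fderiv ℝ (A i k) x v := by
  have hd (i k : Fin 3) := (differentiableAt_dev_Gm hA i k).hasFDerivAt
  have h := (hρ.hasFDerivAt.const_mul (1 / 4 * cs ^ 2)).mul (HasFDerivAt.fun_sum
    (u := Finset.univ) fun i _ => HasFDerivAt.fun_sum (u := Finset.univ)
      fun k _ => (hd i k).mul (hd i k))
  have h' : HasFDerivAt (E3 cs ρ A) _ x := h
  have key := sum_dev_mul_dev_variation (A := A) (x := x) fun i k => fderiv ℝ (A i k) x v
  have hEA : ∑ i, ∑ k, EA cs A i k x * fderiv ℝ (A i k) x v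
      = cs ^ 2 * ∑ i, ∑ k, (∑ j, A i j x * dev (Gm A x) j k) * fderiv ℝ (A i k) x v := by
    simp only [EA, mul_assoc, ← Finset.mul_sum]
  rw [h'.fderiv, hEA]
  simp only [add_apply, smul_apply,
    sum_apply, smul_eq_mul, fderiv_dev_Gm hA, fderiv_Gm hA, ← two_mul,
    ← Finset.mul_sum, key, Pi.mul_apply]
  ring

/-- The work of the distortion stress: `ρ E_A : (A ∇u) = σ : ∇u`. -/
theorem rho_mul_sum_EA_mul (L : Fin 3 → Fin 3 → ℝ) :
    ρ x * ∑ i, ∑ k, EA cs A i k x * ∑ m, A i m x * L m k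
      = ∑ m, ∑ k, sigm cs ρ A m k x * L m k := by
  generalize hN : dev (Gm A x) = N
  simp only [EA, sigm, hN]
  simp only [Gm, Fin.sum_univ_three]
  ring

end Energies

/-- **Thermodynamic compatibility of the original GPR model.**
If the smooth fields `ρ, u, A, J, S` satisfy the GPR system (mass, momentum,
distortion, thermal impulse, entropy) on the open set `Ω`, then the energy
conservation law holds pointwise on `Ω`. -/
theorem gpr_thermodynamically_compatible
    (Ω : Set Pt) (hΩ : IsOpen Ω)
    (cs ch γ cv : ℝ) (g : Fin 3 → ℝ)
    (hcs : 0 ≤ cs) (hch : 0 ≤ ch) (hγ : 1 < γ) (hcv : 0 < cv)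
    (ρ S θ₁ θ₂ : Pt → ℝ) (u J : Fin 3 → Pt → ℝ)
    (A : Fin 3 → Fin 3 → Pt → ℝ)
    (hρ : ContDiffOn ℝ (⊤ : ℕ∞) ρ Ω) (hρpos : ∀ x ∈ Ω, 0 < ρ x)
    (hS : ContDiffOn ℝ (⊤ : ℕ∞) S Ω)
    (hθ₁ : ContDiffOn ℝ (⊤ : ℕ∞) θ₁ Ω) (hθ₁ne : ∀ x ∈ Ω, θ₁ x ≠ 0)
    (hθ₂ : ContDiffOn ℝ (⊤ : ℕ∞) θ₂ Ω) (hθ₂ne : ∀ x ∈ Ω, θ₂ x ≠ 0)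
    (hu : ∀ i, ContDiffOn ℝ (⊤ : ℕ∞) (u i) Ω)
    (hJ : ∀ k, ContDiffOn ℝ (⊤ : ℕ∞) (J k) Ω)
    (hA : ∀ i k, ContDiffOn ℝ (⊤ : ℕ∞) (A i k) Ω)
    -- (i) conservation of mass
    (hmass : ∀ x ∈ Ω,
      pdt ρ x + ∑ k, pd k (fun y => ρ y * u k y) x = 0)
    -- (ii) momentum balance
    (hmom : ∀ x ∈ Ω, ∀ i,
      pdt (fun y => ρ y * u i y) x
        + ∑ k, pd k (fun y => ρ y * u i y * u k y) x
        + pd i (press γ cv ρ S) x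
        + ∑ k, pd k (sigm cs ρ A i k) x
        + ∑ k, pd k (omeg ch ρ J i k) x
      = ρ x * g i)
    -- (iii) distortion field
    (hdist : ∀ x ∈ Ω, ∀ i k,
      pdt (A i k) x
        + pd k (fun y => ∑ m, u m y * A i m y) x
        + ∑ j, u j x * pd j (A i k) x
        - ∑ j, u j x * pd k (A i j) x
      = -(1 / θ₁ x) * EA cs A i k x)
    -- (iv) thermal impulse
    (hJeq : ∀ x ∈ Ω, ∀ k,
      pdt (J k) x
        + pd k (fun y => ∑ m, J m y * u m y) x
        + pd k (temp γ cv ρ S) x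
        + ∑ j, u j x * (pd j (J k) x - pd k (J j) x)
      = -(1 / θ₂ x) * EJ ch J k x)
    -- (v) entropy balance
    (hent : ∀ x ∈ Ω,
      pdt (fun y => ρ y * S y) x
        + ∑ k, pd k (fun y => ρ y * S y * u k y) x
        + ∑ k, pd k (fun y => ρ y * EJ ch J k y) x
      = (ρ x / temp γ cv ρ S x) *
          ((1 / θ₁ x) * ∑ i, ∑ k, EA cs A i k x * EA cs A i k x
            + (1 / θ₂ x) * ∑ k, EJ ch J k x * EJ ch J k x)) :
    -- energy conservation law
    ∀ x ∈ Ω,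
      pdt (Etot γ cv cs ch ρ S u J A) x
        + ∑ k, pd k (fun y => Etot γ cv cs ch ρ S u J A y * u k y) x
        + ∑ k, pd k (fun y => press γ cv ρ S y * u k y) x
        + ∑ i, ∑ k, pd k (fun y => u i y * sigm cs ρ A i k y) x
        + ∑ i, ∑ k, pd k (fun y => u i y * omeg ch ρ J i k y) x
        + ∑ k, pd k (heatq γ cv ch ρ S J k) x
      = ρ x * ∑ i, g i * u i x := by
  intro x hx
  have hΩx := hΩ.mem_nhds hx
  have dρ := (hρ.contDiffAt hΩx).differentiableAt (by simp)
  have dS := (hS.contDiffAt hΩx).differentiableAt (by simp)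
  have du (i) := ((hu i).contDiffAt hΩx).differentiableAt (by simp)
  have dJ (i) := ((hJ i).contDiffAt hΩx).differentiableAt (by simp)
  have dA (i k) := ((hA i k).contDiffAt hΩx).differentiableAt (by simp)
  have hρ0 : ρ x ≠ 0 := (hρpos x hx).ne'
  have hE1 := hasFDerivAt_E1 (γ := γ) (cv := cv) dρ dS hρ0
  have dE1 := hE1.differentiableAt
  have dp : DifferentiableAt ℝ (press γ cv ρ S) x := dE1.const_mul _
  have dT : DifferentiableAt ℝ (temp γ cv ρ S) x := by
    unfold temp
    fun_prop (disch := exact mul_ne_zero hρ0 hcv.ne')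
  have dσ := differentiableAt_sigm (cs := cs) dρ dA
  have dω (i k) : DifferentiableAt ℝ (omeg ch ρ J i k) x := by
    unfold omeg
    fun_prop
  have dE2 := differentiableAt_E2 dρ du
  have dE3 := differentiableAt_E3 (cs := cs) dρ dA
  have dE4 : DifferentiableAt ℝ (E4 ch ρ J) x := by
    rw [E4_eq_E2]
    exact (differentiableAt_E2 dρ dJ).const_mul _
  have dE : DifferentiableAt ℝ (Etot γ cv cs ch ρ S u J A) x := ((dE1.add dE2).add dE3).add dE4
  have dEJ (k) : DifferentiableAt ℝ (EJ ch J k) x := (dJ k).const_mul _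
  have hT0 : temp γ cv ρ S x ≠ 0 := by
    have := hρpos x hx
    have := sub_pos.2 hγ
    unfold temp E1
    positivity
  have hE1T : E1 γ cv ρ S x / cv = ρ x * temp γ cv ρ S x := by
    unfold temp
    field_simp
  set w : Pt := (fun k => u k x, 1)
  have hD (f : Pt → ℝ) : fderiv ℝ f x w = pdt f x + ∑ k, u k x * pd k f x :=
    fderiv_apply_material f x _
  have mass : fderiv ℝ ρ x w = -(ρ x * ∑ k, pd k (u k) x) := by
    have h := hmass x hx
    simp only [pd_mul dρ (du _)] at h
    rw [hD]
    simp only [Fin.sum_univ_three] at h ⊢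
    linear_combination h
  have mom (i) : ρ x * fderiv ℝ (u i) x w = ρ x * g i - pd i (press γ cv ρ S) x
      - ∑ k, pd k (sigm cs ρ A i k) x - ∑ k, pd k (omeg ch ρ J i k) x := by
    have h := hmom x hx i
    simp only [pd_mul (dρ.fun_mul (du i)) (du _), pd_mul dρ (du _), pdt_mul dρ (du _)] at h
    rw [hD] at mass ⊢
    simp only [Fin.sum_univ_three] at h mass ⊢
    linear_combination h - u i x * mass
  have dist (i k) : fderiv ℝ (A i k) x w
      = -(∑ m, A i m x * pd k (u m) x) - (1 / θ₁ x) * EA cs A i k x := by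
    have h := hdist x hx i k
    rw [pd_sum_mul du (dA i)] at h
    rw [hD]
    simp only [Fin.sum_univ_three] at h ⊢
    linear_combination h
  have imp (k) : fderiv ℝ (J k) x w = -(∑ m, J m x * pd k (u m) x)
      - pd k (temp γ cv ρ S) x - (1 / θ₂ x) * EJ ch J k x := by
    have h := hJeq x hx k
    rw [pd_sum_mul dJ du] at h
    rw [hD]
    simp only [Fin.sum_univ_three] at h ⊢
    linear_combination h
  have ent : ρ x * temp γ cv ρ S x * fderiv ℝ S x w
      = -(temp γ cv ρ S x * ∑ k, pd k (fun y => ρ y * EJ ch J k y) x)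
        + ρ x * ((1 / θ₁ x) * ∑ i, ∑ k, EA cs A i k x * EA cs A i k x
          + (1 / θ₂ x) * ∑ k, EJ ch J k x * EJ ch J k x) := by
    have h := hent x hx
    simp only [pd_mul (dρ.fun_mul dS) (du _), pd_mul dρ dS, pdt_mul dρ dS] at h
    rw [div_mul_eq_mul_div, eq_div_iff hT0] at h
    rw [hD] at mass ⊢
    generalize ρ x * ((1 / θ₁ x) * ∑ i, ∑ k, EA cs A i k x * EA cs A i k x
          + (1 / θ₂ x) * ∑ k, EJ ch J k x * EJ ch J k x) = R at h ⊢
    simp only [Fin.sum_univ_three] at h mass ⊢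
    linear_combination h - temp γ cv ρ S x * S x * mass
  have energy₁ : fderiv ℝ (E1 γ cv ρ S) x w
      = -((E1 γ cv ρ S x + press γ cv ρ S x) * ∑ k, pd k (u k) x)
        + ρ x * temp γ cv ρ S x * fderiv ℝ S x w := by
    rw [hE1.fderiv]
    simp only [add_apply, smul_apply, smul_eq_mul, mass,
      hE1T, press]
    field_simp
    ring
  have energy₂ : fderiv ℝ (E2 ρ u) x w = -(E2 ρ u x * ∑ k, pd k (u k) x)
      + ∑ i, u i x * (ρ x * fderiv ℝ (u i) x w) := by
    rw [fderiv_E2 dρ du, mass, E2]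
    simp only [Fin.sum_univ_three]
    ring
  have energy₃ : fderiv ℝ (E3 cs ρ A) x w = -(E3 cs ρ A x * ∑ k, pd k (u k) x)
      - ∑ m, ∑ k, sigm cs ρ A m k x * pd k (u m) x
      - ρ x * (1 / θ₁ x) * ∑ i, ∑ k, EA cs A i k x * EA cs A i k x := by
    rw [fderiv_E3 dρ dA, mass, E3, ← rho_mul_sum_EA_mul]
    simp only [dist]
    simp only [mul_sub, mul_neg, Finset.sum_sub_distrib, Finset.sum_neg_distrib,
      mul_left_comm _ (1 / θ₁ x), ← Finset.mul_sum]
    ring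
  have energy₄ : fderiv ℝ (E4 ch ρ J) x w = -(E4 ch ρ J x * ∑ k, pd k (u k) x)
      - ∑ m, ∑ k, omeg ch ρ J m k x * pd k (u m) x
      - ρ x * ∑ k, EJ ch J k x * pd k (temp γ cv ρ S) x
      - ρ x * (1 / θ₂ x) * ∑ k, EJ ch J k x * EJ ch J k x := by
    rw [E4_eq_E2, fderiv_const_mul (differentiableAt_E2 dρ dJ), smul_apply,
      fderiv_E2 dρ dJ, mass, smul_eq_mul]
    simp only [imp]
    simp only [E2, omeg, EJ, Fin.sum_univ_three]
    ring
  have heat (k) : pd k (heatq γ cv ch ρ S J k) x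
      = temp γ cv ρ S x * pd k (fun y => ρ y * EJ ch J k y) x
        + ρ x * (EJ ch J k x * pd k (temp γ cv ρ S) x) := by
    have h : heatq γ cv ch ρ S J k = fun y => temp γ cv ρ S y * (ρ y * EJ ch J k y) := by
      ext y
      simp only [heatq, EJ]
      ring
    rw [h, pd_mul dT (dρ.fun_mul (dEJ k))]
    ring
  have energy : fderiv ℝ (Etot γ cv cs ch ρ S u J A) x w
      = fderiv ℝ (E1 γ cv ρ S) x w + fderiv ℝ (E2 ρ u) x w + fderiv ℝ (E3 cs ρ A) x w
        + fderiv ℝ (E4 ch ρ J) x w := by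
    have h : HasFDerivAt (Etot γ cv cs ch ρ S u J A) _ x :=
      ((dE1.hasFDerivAt.add dE2.hasFDerivAt).add dE3.hasFDerivAt).add dE4.hasFDerivAt
    rw [h.fderiv]
    rfl
  have total : Etot γ cv cs ch ρ S u J A x
      = E1 γ cv ρ S x + E2 ρ u x + E3 cs ρ A x + E4 ch ρ J x := rfl
  simp only [mom] at energy₂
  rw [ent] at energy₁
  rw [energy₁, energy₂, energy₃, energy₄, hD] at energy
  simp only [pd_mul dE (du _), pd_mul dp (du _), pd_mul (du _) (dσ _ _), pd_mul (du _) (dω _ _),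
    heat]
  rw [total]
  generalize ∑ i, ∑ k, EA cs A i k x * EA cs A i k x = Q₁ at energy
  generalize ∑ k, EJ ch J k x * EJ ch J k x = Q₂ at energy
  simp only [Fin.sum_univ_three] at energy ⊢
  linear_combination energy
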